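/- (Clifford/oscillator construction of linear evaluation.) Let A be a unital associative ℂ-algebra and let c_a ∈ A (a ∈ I) satisfy c_a c_b + ε c_b c_a = ε ε_{ab}·1 for all a,b ∈ I. Define G_{ab} := (ε/2) ε_{ab}·1 − c_a c_b. Then: (i) G_{ab} + ε G_{ba} = 0; (ii) the orthogonal/symplectic Lie algebra relations hold: [G_{ab}, G_{cd}] = −ε_{cb} G_{ad} + ε_{ad} G_{cb} + ε_{ac} G_{bd} − ε_{db} G_{ca}; (iii) the matrix M with entries M^a_b = Σ_c ε^{ac} G_{cb} satisfies M² + βM = (ε/4)(n − ε)·Id. -/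

import Mathlib

noncomputable section

/-- The index set `I = {-m,…,-1,(0),1,…,m}` (the value `0` is included iff `zero = true`). -/
def Idx (m : ℤ) (zero : Bool) : Finset ℤ :=
  if zero then Finset.Icc (-m) m else (Finset.Icc (-m) m).erase 0

/-- The dimension `n` of the fundamental representation: `2m` or `2m+1`. -/
def nDim (m : ℤ) (zero : Bool) : ℤ := if zero then 2 * m + 1 else 2 * m

/-- `β = n/2 - ε`. -/
def betaC (m : ℤ) (zero : Bool) (sgn : ℂ) : ℂ := (nDim m zero : ℂ) / 2 - sgn

/-- The metric `ε_{ab} = ε_a δ_{a,-b}` with `ε_i = 1` for `i ≥ 0`, `ε_{-i} = ε`. -/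
def met (sgn : ℂ) (a b : ℤ) : ℂ :=
  if a = -b then (if 0 ≤ a then 1 else sgn) else 0

/-- The inverse metric `ε^{ab}`, satisfying `Σ_c ε_{ac} ε^{cb} = δ_a^b`. -/
def metUp (sgn : ℂ) (a b : ℤ) : ℂ :=
  if a = -b then (if 0 ≤ b then 1 else sgn) else 0

/-- The fundamental R-matrix
`R(u)^{a₁a₂}_{b₁b₂} = u(u+β) δ^{a₁}_{b₁} δ^{a₂}_{b₂} + (u+β) δ^{a₁}_{b₂} δ^{a₂}_{b₁}
  - ε u ε^{a₁a₂} ε_{b₁b₂}`. -/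
def Rmat (m : ℤ) (zero : Bool) (sgn : ℂ) (u : ℂ) (a1 a2 b1 b2 : ℤ) : ℂ :=
  u * (u + betaC m zero sgn) * (if a1 = b1 then 1 else 0) * (if a2 = b2 then 1 else 0)
    + (u + betaC m zero sgn) * (if a1 = b2 then 1 else 0) * (if a2 = b1 then 1 else 0)
    - sgn * u * metUp sgn a1 a2 * met sgn b1 b2

/-- The RLL relation for a matrix-valued function `L` with entries in a `ℂ`-algebra `A`. -/
def RLL (m : ℤ) (zero : Bool) (sgn : ℂ) {A : Type*} [Ring A] [Algebra ℂ A]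
    (L : ℂ → ℤ → ℤ → A) : Prop :=
  ∀ u v : ℂ, ∀ a1 ∈ Idx m zero, ∀ a2 ∈ Idx m zero, ∀ c1 ∈ Idx m zero, ∀ c2 ∈ Idx m zero,
    (∑ b1 ∈ Idx m zero, ∑ b2 ∈ Idx m zero,
      Rmat m zero sgn (u - v) a1 a2 b1 b2 • (L u b1 c1 * L v b2 c2))
    = ∑ b1 ∈ Idx m zero, ∑ b2 ∈ Idx m zero,
      Rmat m zero sgn (u - v) b1 b2 c1 c2 • (L v a2 b2 * L u a1 b1)

/-- Lowered-index entries `L_{ab}(u) = Σ_c ε_{ac} L^c_b(u)`. -/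
def Llow (m : ℤ) (zero : Bool) (sgn : ℂ) {A : Type*} [Ring A] [Algebra ℂ A]
    (L : ℂ → ℤ → ℤ → A) (u : ℂ) (a b : ℤ) : A :=
  ∑ c ∈ Idx m zero, met sgn a c • L u c b

/-- Lowered-index entries of a single matrix: `M_{ab} = Σ_c ε_{ac} M^c_b`. -/
def lowMat (m : ℤ) (zero : Bool) (sgn : ℂ) {A : Type*} [Ring A] [Algebra ℂ A]
    (M : ℤ → ℤ → A) (a b : ℤ) : A :=
  ∑ c ∈ Idx m zero, met sgn a c • M c b

/-- The entries of `L(u)` are polynomial in the spectral parameter `u`. -/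
def IsPolyFam {A : Type*} [Ring A] [Algebra ℂ A] (L : ℂ → ℤ → ℤ → A) : Prop :=
  ∃ (N : ℕ) (coef : ℕ → ℤ → ℤ → A), ∀ (u : ℂ) (a b : ℤ),
    L u a b = ∑ k ∈ Finset.range (N + 1), u ^ k • coef k a b

theorem neg_mem_Idx {m : ℤ} {zero : Bool} {a : ℤ} (ha : a ∈ Idx m zero) : -a ∈ Idx m zero := by
  unfold Idx at *
  split_ifs at * <;> simp only [Finset.mem_erase, Finset.mem_Icc] at * <;> omega

theorem eq_one_of_zero_mem_Idx {m : ℤ} {zero : Bool} {sgn : ℂ} (hz : zero = true → sgn = 1)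
    (h : (0 : ℤ) ∈ Idx m zero) : sgn = 1 := by
  cases zero
  · simp [Idx] at h
  · exact hz rfl

theorem card_Idx {m : ℤ} (hm : 1 ≤ m) (zero : Bool) :
    ((Idx m zero).card : ℂ) = (nDim m zero : ℂ) := by
  have h : ((Idx m zero).card : ℤ) = nDim m zero := by
    cases zero
    · have h0 : (0 : ℤ) ∈ Finset.Icc (-m) m := by rw [Finset.mem_Icc]; omega
      simp only [Idx, nDim, Bool.false_eq_true, if_false, Finset.card_erase_of_mem h0,
        Int.card_Icc]
      omega
    · simp only [Idx, nDim, if_true, Int.card_Icc]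
      omega
  exact_mod_cast congrArg (Int.cast : ℤ → ℂ) h

theorem met_swap {m : ℤ} {zero : Bool} {sgn : ℂ} (hsgn : sgn = 1 ∨ sgn = -1)
    (hz : zero = true → sgn = 1) {a : ℤ} (ha : a ∈ Idx m zero) (b : ℤ) :
    met sgn b a = sgn * met sgn a b := by
  unfold met
  by_cases hab : a = -b
  · rcases lt_trichotomy a 0 with h | h | h
    · rw [if_pos (by omega), if_pos (by omega), if_pos hab, if_neg (by omega)]
      rcases hsgn with rfl | rfl <;> norm_num
    · have := eq_one_of_zero_mem_Idx hz (h ▸ ha)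
      simp [this, hab]
    · rw [if_pos (by omega), if_neg (by omega), if_pos hab, if_pos (by omega), mul_one]
  · rw [if_neg (by omega), if_neg hab, mul_zero]

theorem metUp_mul_met {sgn : ℂ} (hsgn : sgn = 1 ∨ sgn = -1) (a b : ℤ) :
    metUp sgn a (-a) * met sgn (-a) b = if a = b then 1 else 0 := by
  unfold metUp met
  rcases hsgn with rfl | rfl <;> split_ifs <;> first | omega | norm_num

theorem metUp_neg {m : ℤ} {zero : Bool} {sgn : ℂ} (hsgn : sgn = 1 ∨ sgn = -1)
    (hz : zero = true → sgn = 1) {a : ℤ} (ha : a ∈ Idx m zero) :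
    metUp sgn (-a) a = sgn * metUp sgn a (-a) := by
  have h := met_swap hsgn hz ha (-a)
  have h1 : metUp sgn (-a) a = met sgn a (-a) := by simp [metUp, met]
  have h2 : metUp sgn a (-a) = met sgn (-a) a := by simp [metUp, met]
  rw [h1, h2, h]
  rcases hsgn with rfl | rfl <;> ring

theorem sum_metUp_smul {m : ℤ} {zero : Bool} (sgn : ℂ) {A : Type*} [Ring A] [Algebra ℂ A]
    {a : ℤ} (ha : a ∈ Idx m zero) (f : ℤ → A) :
    ∑ y ∈ Idx m zero, metUp sgn a y • f y = metUp sgn a (-a) • f (-a) := by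
  refine Finset.sum_eq_single_of_mem _ (neg_mem_Idx ha) fun y _ hy => ?_
  rw [metUp, if_neg (by omega), zero_smul]

/-- The contraction `Σ_x c_x c^x` of the Clifford/oscillator generators is `n/2`. -/
theorem sum_mul_raised {m : ℤ} (hm : 1 ≤ m) {zero : Bool} {sgn : ℂ}
    (hsgn : sgn = 1 ∨ sgn = -1) (hz : zero = true → sgn = 1)
    {A : Type*} [Ring A] [Algebra ℂ A] {c : ℤ → A}
    (hcliff : ∀ a ∈ Idx m zero, ∀ b ∈ Idx m zero,
      c a * c b + sgn • (c b * c a) = (sgn * met sgn a b) • (1 : A)) :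
    ∑ x ∈ Idx m zero, c x * metUp sgn x (-x) • c (-x) = ((nDim m zero : ℂ) / 2) • (1 : A) := by
  have hreindex : ∑ x ∈ Idx m zero, c x * metUp sgn x (-x) • c (-x)
      = ∑ x ∈ Idx m zero, c (-x) * metUp sgn (-x) x • c x :=
    Finset.sum_nbij' (fun x => -x) (fun x => -x) (fun _ h => neg_mem_Idx h)
      (fun _ h => neg_mem_Idx h) (by simp) (by simp) (by simp)
  have hpair : ∀ x ∈ Idx m zero,
      c x * metUp sgn x (-x) • c (-x) + c (-x) * metUp sgn (-x) x • c x = 1 := by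
    intro x hx
    have hmm := metUp_mul_met hsgn x x
    rw [if_pos rfl] at hmm
    have hscal : metUp sgn x (-x) * (sgn * met sgn x (-x)) = 1 := by
      rw [← met_swap hsgn hz hx, hmm]
    have h := congrArg (metUp sgn x (-x) • ·) (hcliff x hx (-x) (neg_mem_Idx hx))
    simp only [smul_smul, hscal, one_smul] at h
    rw [← h, metUp_neg hsgn hz hx, mul_smul_comm, mul_smul_comm]
    module
  have htwo : (2 : ℂ) • ∑ x ∈ Idx m zero, c x * metUp sgn x (-x) • c (-x)
      = (nDim m zero : ℂ) • (1 : A) := by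
    rw [two_smul]
    nth_rewrite 2 [hreindex]
    rw [← Finset.sum_add_distrib, Finset.sum_congr rfl hpair, Finset.sum_const, ← card_Idx hm,
      Nat.cast_smul_eq_nsmul]
  rw [div_eq_inv_mul, mul_smul, ← htwo, smul_smul]
  norm_num

/-- Commutator of two quadratic monomials in Clifford (`s = 1`) or oscillator (`s = -1`)
generators. -/
theorem commutator_quadratic {A : Type*} [Ring A] [Algebra ℂ A] {s p q r t : ℂ}
    (hs : s = 1 ∨ s = -1) {a b x y : A}
    (hbx : b * x + s • (x * b) = p • (1 : A)) (hby : b * y + s • (y * b) = q • (1 : A))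
    (hax : a * x + s • (x * a) = r • (1 : A)) (hay : a * y + s • (y * a) = t • (1 : A)) :
    a * b * (x * y) - x * y * (a * b)
      = p • (a * y) - (s * q) • (a * x) + r • (y * b) - (s * t) • (x * b) := by
  have h1 : a * b * (x * y) = a * (b * x) * y := by simp only [mul_assoc]
  have h2 : a * (x * b) * y = a * x * (b * y) := by simp only [mul_assoc]
  have h3 : x * a * (y * b) = x * (a * y) * b := by simp only [mul_assoc]
  have h4 : x * (y * a) * b = x * y * (a * b) := by simp only [mul_assoc]
  have e1 : a * (b * x) * y = p • (a * y) - s • (a * x * (b * y)) := by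
    rw [eq_sub_of_add_eq hbx, ← h2]
    simp only [mul_sub, sub_mul, mul_smul_comm, smul_mul_assoc, mul_one]
  have e2 : a * x * (b * y) = q • (a * x) - s • (a * x * (y * b)) := by
    rw [eq_sub_of_add_eq hby]
    simp only [mul_sub, mul_smul_comm, mul_one]
  have e3 : a * x * (y * b) = r • (y * b) - s • (x * (a * y) * b) := by
    rw [eq_sub_of_add_eq hax, ← h3]
    simp only [sub_mul, smul_mul_assoc, one_mul]
  have e4 : x * (a * y) * b = t • (x * b) - s • (x * y * (a * b)) := by
    rw [eq_sub_of_add_eq hay, ← h4]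
    simp only [mul_sub, sub_mul, mul_smul_comm, smul_mul_assoc, mul_one]
  rw [h1, e1, e2, e3, e4]
  rcases hs with rfl | rfl <;> module

/-- Clifford/oscillator construction of the linear evaluation. -/
theorem stmt16 (m : ℤ) (zero : Bool) (sgn : ℂ) (hm : 1 ≤ m)
    (hsgn : sgn = 1 ∨ sgn = -1) (hz : zero = true → sgn = 1)
    (A : Type*) [Ring A] [Algebra ℂ A]
    (c : ℤ → A)
    (hcliff : ∀ a ∈ Idx m zero, ∀ b ∈ Idx m zero,
      c a * c b + sgn • (c b * c a) = (sgn * met sgn a b) • (1 : A))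
    (G : ℤ → ℤ → A)
    (hG : ∀ a b : ℤ, G a b = (sgn / 2 * met sgn a b) • (1 : A) - c a * c b) :
    (∀ a ∈ Idx m zero, ∀ b ∈ Idx m zero, G a b + sgn • G b a = 0)
    ∧ (∀ a ∈ Idx m zero, ∀ b ∈ Idx m zero, ∀ x ∈ Idx m zero, ∀ y ∈ Idx m zero,
        G a b * G x y - G x y * G a b
          = -(met sgn x b • G a y) + met sgn a y • G x b
            + met sgn a x • G b y - met sgn y b • G x a)
    ∧ (∀ a ∈ Idx m zero, ∀ b ∈ Idx m zero,
        (∑ x ∈ Idx m zero,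
            (∑ y ∈ Idx m zero, metUp sgn a y • G y x)
              * (∑ y ∈ Idx m zero, metUp sgn x y • G y b))
          + betaC m zero sgn • (∑ y ∈ Idx m zero, metUp sgn a y • G y b)
          = (sgn / 4 * ((nDim m zero : ℂ) - sgn)) • (if a = b then (1 : A) else 0)) := by
  refine ⟨fun a ha b hb => ?_, fun a ha b hb x hx y hy => ?_, fun a ha b hb => ?_⟩
  · have h := eq_sub_of_add_eq (hcliff a ha b hb)
    rw [hG, hG, met_swap hsgn hz ha b, h]
    rcases hsgn with rfl | rfl <;> module
  · have hcomm := commutator_quadratic hsgn (hcliff b hb x hx) (hcliff b hb y hy)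
      (hcliff a ha x hx) (hcliff a ha y hy)
    have hleft : G a b * G x y - G x y * G a b
        = c a * c b * (c x * c y) - c x * c y * (c a * c b) := by
      simp only [hG, mul_sub, sub_mul, smul_mul_assoc, mul_smul_comm, one_mul, mul_one]
      module
    rw [hleft, hcomm, hG a y, hG x b, hG b y, hG x a, met_swap hsgn hz hb x,
      met_swap hsgn hz hb y, met_swap hsgn hz ha x, eq_sub_of_add_eq (hcliff b hb y hy),
      eq_sub_of_add_eq (hcliff x hx a ha), met_swap hsgn hz ha x]
    rcases hsgn with rfl | rfl <;> module
  · have hM : ∀ a ∈ Idx m zero, ∀ b, ∑ y ∈ Idx m zero, metUp sgn a y • G y b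
        = (if a = b then sgn / 2 else 0) • (1 : A) - (metUp sgn a (-a) • c (-a)) * c b := by
      intro a ha b
      have hδ : metUp sgn a (-a) * (sgn / 2 * met sgn (-a) b)
          = if a = b then sgn / 2 else 0 := by
        rw [mul_left_comm, metUp_mul_met hsgn, mul_ite, mul_one, mul_zero]
      rw [sum_metUp_smul sgn ha, hG, smul_sub, smul_smul, hδ, smul_mul_assoc]
    have hcontract := sum_mul_raised hm hsgn hz hcliff
    have hsq : ∑ x ∈ Idx m zero,
          (∑ y ∈ Idx m zero, metUp sgn a y • G y x) * (∑ y ∈ Idx m zero, metUp sgn x y • G y b)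
        = (if a = b then sgn / 2 * (sgn / 2) else 0) • (1 : A)
          + ((nDim m zero : ℂ) / 2 - sgn) • ((metUp sgn a (-a) • c (-a)) * c b) := by
      rw [Finset.sum_congr rfl fun x hx => by rw [hM a ha x, hM x hx b]]
      let d : ℤ → A := fun x => metUp sgn x (-x) • c (-x)
      have hexpand : ∀ x ∈ Idx m zero,
          ((if a = x then sgn / 2 else 0) • (1 : A) - d a * c x)
            * ((if x = b then sgn / 2 else 0) • (1 : A) - d x * c b)
          = (if a = x then (sgn / 2 * (if x = b then sgn / 2 else 0)) • (1 : A)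
                - (sgn / 2) • (d x * c b) else 0)
            - (if x = b then (sgn / 2) • (d a * c x) else 0)
            + d a * (c x * d x) * c b := by
        intro x _
        split_ifs <;>
          simp only [mul_sub, sub_mul, smul_mul_assoc, mul_smul_comm, one_mul, mul_one, zero_smul,
            mul_zero, zero_mul, mul_assoc] <;> module
      rw [Finset.sum_congr rfl hexpand, Finset.sum_add_distrib, Finset.sum_sub_distrib,
        Finset.sum_ite_eq, Finset.sum_ite_eq', if_pos ha, if_pos hb, ← Finset.sum_mul,
        ← Finset.mul_sum, hcontract, mul_smul_comm, mul_one, mul_ite, mul_zero]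
      simp only [d, smul_mul_assoc]
      module
    rw [hsq, hM a ha b, betaC]
    split_ifs <;> rcases hsgn with rfl | rfl <;> module
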